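/- arXiv:1504.07898 — 2 statements merged into one kernel-verified Lean document; each statement's English description precedes it below -/
import Mathlib

section
/- Let f, λ : ℝ^n → ℝ be smooth functions and a ≥ 0 a constant. Suppose f > 0, Δ_f f = n/2 − f, and f ≥ 2n on an open set Ω ⊆ ℝ^n, and suppose Δ_f λ ≤ λ on Ω, where Δ_f u := Δu − ⟨∇f, ∇u⟩ denotes the drift (weighted) Laplacian associated to f. Then the function u := λ − a·f^{-1} − n·a·f^{-2} satisfies Δ_f u ≤ u on Ω. -/
open scoped RealInnerProductSpace

/-- The standard Laplacian on Euclidean space `ℝ^n`, as the trace of the second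
derivative over the standard orthonormal basis. -/
noncomputable def lap {n : ℕ} (u : EuclideanSpace ℝ (Fin n) → ℝ)
    (x : EuclideanSpace ℝ (Fin n)) : ℝ :=
  ∑ i, iteratedFDeriv ℝ 2 u x ![EuclideanSpace.single i 1, EuclideanSpace.single i 1]

/-- The drift (weighted) Laplacian `Δ_f u := Δu − ⟨∇f, ∇u⟩`. -/
noncomputable def driftLap {n : ℕ} (f u : EuclideanSpace ℝ (Fin n) → ℝ)
    (x : EuclideanSpace ℝ (Fin n)) : ℝ :=
  lap u x - ⟪gradient f x, gradient u x⟫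

open Filter Topology

theorem lap_sub {n : ℕ} {u v : EuclideanSpace ℝ (Fin n) → ℝ} {x : EuclideanSpace ℝ (Fin n)}
    (hu : ContDiffAt ℝ 2 u x) (hv : ContDiffAt ℝ 2 v x) :
    lap (fun y => u y - v y) x = lap u x - lap v x := by
  have h : iteratedFDeriv ℝ 2 (fun y => u y - v y) x
      = iteratedFDeriv ℝ 2 u x - iteratedFDeriv ℝ 2 v x :=
    iteratedFDeriv_sub_apply hu hv
  simp only [lap, h, sub_apply, Finset.sum_sub_distrib]

theorem driftLap_sub {n : ℕ} (f : EuclideanSpace ℝ (Fin n) → ℝ)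
    {u v : EuclideanSpace ℝ (Fin n) → ℝ} {x : EuclideanSpace ℝ (Fin n)}
    (hu : ContDiffAt ℝ 2 u x) (hv : ContDiffAt ℝ 2 v x) :
    driftLap f (fun y => u y - v y) x = driftLap f u x - driftLap f v x := by
  have h : gradient (fun y => u y - v y) x = gradient u x - gradient v x := by
    simp only [gradient, ← map_sub]
    rw [fderiv_fun_sub (hu.differentiableAt two_ne_zero) (hv.differentiableAt two_ne_zero)]
  simp only [driftLap, lap_sub hu hv, h, inner_sub_right]
  ring

theorem sum_fderiv_single_sq {n : ℕ} (g : EuclideanSpace ℝ (Fin n) → ℝ)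
    (x : EuclideanSpace ℝ (Fin n)) :
    ∑ i, fderiv ℝ g x (EuclideanSpace.single i 1) ^ 2 = ‖gradient g x‖ ^ 2 := by
  rw [EuclideanSpace.norm_sq_eq]
  refine Finset.sum_congr rfl fun i _ => ?_
  have h : fderiv ℝ g x (EuclideanSpace.single i 1)
      = ⟪gradient g x, EuclideanSpace.single i 1⟫ := by
    rw [gradient, InnerProductSpace.toDual_symm_apply]
  rw [h, EuclideanSpace.inner_single_right]
  simp

theorem fderiv_comp_eventuallyEq {E : Type*} [NormedAddCommGroup E] [NormedSpace ℝ E]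
    {g : E → ℝ} {φ φ' : ℝ → ℝ} {x : E} (hg : ContDiffAt ℝ 2 g x)
    (hφ : ∀ᶠ t in 𝓝 (g x), HasDerivAt φ (φ' t) t) :
    fderiv ℝ (fun y => φ (g y)) =ᶠ[𝓝 x] fun y => φ' (g y) • fderiv ℝ g y := by
  filter_upwards [hg.continuousAt.eventually hφ, hg.eventually (by simp)] with y hy hgy
  exact (hy.comp_hasFDerivAt y (hgy.differentiableAt two_ne_zero).hasFDerivAt).fderiv

/-- The chain rule for the Laplacian. -/
theorem lap_comp {n : ℕ} {g : EuclideanSpace ℝ (Fin n) → ℝ} {φ φ' : ℝ → ℝ} {c : ℝ}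
    {x : EuclideanSpace ℝ (Fin n)} (hg : ContDiffAt ℝ 2 g x)
    (hφ : ∀ᶠ t in 𝓝 (g x), HasDerivAt φ (φ' t) t) (hφ' : HasDerivAt φ' c (g x)) :
    lap (fun y => φ (g y)) x = φ' (g x) * lap g x + c * ‖gradient g x‖ ^ 2 := by
  have hdg : DifferentiableAt ℝ (fderiv ℝ g) x :=
    (hg.fderiv_right (m := 1) (by norm_num)).differentiableAt one_ne_zero
  have h : fderiv ℝ (fun y => φ' (g y) • fderiv ℝ g y) x
      = φ' (g x) • fderiv ℝ (fderiv ℝ g) x + (c • fderiv ℝ g x).smulRight (fderiv ℝ g x) :=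
    ((hφ'.comp_hasFDerivAt x (hg.differentiableAt two_ne_zero).hasFDerivAt).smul
      hdg.hasFDerivAt).fderiv
  rw [← sum_fderiv_single_sq, lap, lap, Finset.mul_sum, Finset.mul_sum,
    ← Finset.sum_add_distrib]
  refine Finset.sum_congr rfl fun i _ => ?_
  rw [iteratedFDeriv_two_apply, iteratedFDeriv_two_apply,
    (fderiv_comp_eventuallyEq hg hφ).fderiv_eq, h]
  simp
  ring

/-- The chain rule for the drift Laplacian. -/
theorem driftLap_comp {n : ℕ} (f : EuclideanSpace ℝ (Fin n) → ℝ)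
    {g : EuclideanSpace ℝ (Fin n) → ℝ} {φ φ' : ℝ → ℝ} {c : ℝ}
    {x : EuclideanSpace ℝ (Fin n)} (hg : ContDiffAt ℝ 2 g x)
    (hφ : ∀ᶠ t in 𝓝 (g x), HasDerivAt φ (φ' t) t) (hφ' : HasDerivAt φ' c (g x)) :
    driftLap f (fun y => φ (g y)) x = φ' (g x) * driftLap f g x + c * ‖gradient g x‖ ^ 2 := by
  have h : gradient (fun y => φ (g y)) x = φ' (g x) • gradient g x := by
    rw [gradient, (fderiv_comp_eventuallyEq hg hφ).eq_of_nhds, map_smulₛₗ]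
    rfl
  rw [driftLap, driftLap, lap_comp hg hφ hφ', h, inner_smul_right]
  ring

/-- Let `f, λ : ℝ^n → ℝ` be smooth and `a ≥ 0` a constant. If on an
open set `Ω` one has `f > 0`, `Δ_f f = n/2 − f`, `f ≥ 2n`, and `Δ_f λ ≤ λ`, then
the function `u := λ − a·f⁻¹ − n·a·f⁻²` satisfies `Δ_f u ≤ u` on `Ω`. -/
theorem driftLaplacian_auxiliary_inequality {n : ℕ}
    (f lam : EuclideanSpace ℝ (Fin n) → ℝ) (a : ℝ) (ha : 0 ≤ a)
    (hf : ContDiff ℝ (⊤ : ℕ∞) f) (hlam : ContDiff ℝ (⊤ : ℕ∞) lam)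
    (Ω : Set (EuclideanSpace ℝ (Fin n))) (hΩ : IsOpen Ω)
    (hfpos : ∀ x ∈ Ω, 0 < f x)
    (heq : ∀ x ∈ Ω, driftLap f f x = n / 2 - f x)
    (hf2n : ∀ x ∈ Ω, (2 * n : ℝ) ≤ f x)
    (hlamineq : ∀ x ∈ Ω, driftLap f lam x ≤ lam x) :
    ∀ x ∈ Ω,
      driftLap f (fun y => lam y - a * (f y)⁻¹ - n * a * (f y) ^ (-2 : ℤ)) x
        ≤ lam x - a * (f x)⁻¹ - n * a * (f x) ^ (-2 : ℤ) := by
  intro x hx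
  have hx0 := hfpos x hx
  have hf2 : ContDiffAt ℝ 2 f x := (contDiff_infty.mp hf 2).contDiffAt
  have hlam2 : ContDiffAt ℝ 2 lam x := (contDiff_infty.mp hlam 2).contDiffAt
  set φ : ℝ → ℝ := fun t => a * t ^ (-1 : ℤ) + n * a * t ^ (-2 : ℤ) with hφ_def
  set φ' : ℝ → ℝ := fun t => -a * t ^ (-2 : ℤ) - 2 * n * a * t ^ (-3 : ℤ) with hφ'_def
  have hφ : ∀ᶠ t in 𝓝 (f x), HasDerivAt φ (φ' t) t := by
    filter_upwards [eventually_ne_nhds hx0.ne'] with t ht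
    refine (((hasDerivAt_zpow (-1) t (.inl ht)).const_mul a).add
      ((hasDerivAt_zpow (-2) t (.inl ht)).const_mul (n * a))).congr_deriv ?_
    norm_num [hφ'_def]
    ring
  have hφ' : HasDerivAt φ' (2 * a * f x ^ (-3 : ℤ) + 6 * n * a * f x ^ (-4 : ℤ)) (f x) := by
    refine (((hasDerivAt_zpow (-2) (f x) (.inl hx0.ne')).const_mul (-a)).sub
      ((hasDerivAt_zpow (-3) (f x) (.inl hx0.ne')).const_mul (2 * n * a))).congr_deriv ?_
    norm_num
    ring
  have hφf : ContDiffAt ℝ 2 (fun y => φ (f y)) x := by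
    have hinv : ContDiffAt ℝ 2 (fun y => (f y)⁻¹) x := hf2.inv hx0.ne'
    have h : (fun y => φ (f y)) = fun y => a * (f y)⁻¹ + n * a * ((f y)⁻¹) ^ 2 := by
      ext y
      simp [hφ_def, zpow_neg]
    rw [h]
    exact (contDiffAt_const.mul hinv).add (contDiffAt_const.mul (hinv.pow 2))
  have hu : (fun y => lam y - a * (f y)⁻¹ - n * a * f y ^ (-2 : ℤ))
      = fun y => lam y - φ (f y) := by
    ext y
    simp [hφ_def, sub_sub]
  have hφ_le : φ (f x) ≤ driftLap f (fun y => φ (f y)) x := by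
    rw [driftLap_comp f hf2 hφ hφ', heq x hx]
    have hgrad : 0 ≤ (2 * a * f x ^ (-3 : ℤ) + 6 * n * a * f x ^ (-4 : ℤ))
        * ‖gradient f x‖ ^ 2 := by positivity
    have hmain : φ' (f x) * (n / 2 - f x) - φ (f x)
        = n * a * f x ^ (-3 : ℤ) * ((f x - 2 * n) / 2) := by
      simp only [hφ_def, hφ'_def]
      field_simp
      ring
    have hnonneg : 0 ≤ n * a * f x ^ (-3 : ℤ) * ((f x - 2 * n) / 2) :=
      mul_nonneg (by positivity) (by linarith [hf2n x hx])
    linarith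
  rw [hu, driftLap_sub f hlam2 hφf, congrFun hu x]
  linarith [hlamineq x hx]
end

section
/- Let f, S : ℝ^n → ℝ be smooth and let b be a constant with 0 < b ≤ 1. Suppose: (i) S > 0 everywhere; (ii) |∇f|² = f − S everywhere; (iii) f(x) → ∞ as |x| → ∞; and (iv) ⟨∇S(x), ∇f(x)⟩ ≥ (2b / f(x)) · |∇f(x)|² at every point x with f(x) ≥ 1. Then S(x) ≥ b · ln f(x) for every x with f(x) ≥ 1. -/
open scoped RealInnerProductSpace

/-- A function with negative derivative at `a` takes smaller values just to the right of `a`. -/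
theorem HasDerivAt.eventually_nhdsGT_lt_of_neg {g : ℝ → ℝ} {g' a : ℝ}
    (hg : HasDerivAt g g' a) (hneg : g' < 0) : ∀ᶠ t in nhdsWithin a (Set.Ioi a), g t < g a := by
  have h := (hg.tendsto_slope.mono_left (nhdsGT_le_nhdsNE a)).eventually_lt_const hneg
  filter_upwards [h, self_mem_nhdsWithin] with t ht hta
  have hta' : 0 < t - a := sub_pos.2 hta
  rw [slope_def_field, div_lt_iff₀ hta', zero_mul] at ht
  linarith

/-- The derivative of a function along the line `t ↦ p - t • v` at `t = 0`. -/
theorem DifferentiableAt.hasDerivAt_comp_sub_smul {E : Type*} [NormedAddCommGroup E]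
    [InnerProductSpace ℝ E] [CompleteSpace E] {h : E → ℝ} {p : E}
    (hh : DifferentiableAt ℝ h p) (v : E) :
    HasDerivAt (fun t : ℝ => h (p - t • v)) (-⟪gradient h p, v⟫) 0 := by
  have hline : HasDerivAt (fun t : ℝ => p - t • v) (-v) 0 := by
    simpa using ((hasDerivAt_id (0 : ℝ)).smul_const v).const_sub p
  have hh' : HasFDerivAt h (InnerProductSpace.toDual ℝ E (gradient h p))
      (p - (0 : ℝ) • v) := by
    simpa using hh.hasGradientAt.hasFDerivAt
  simpa [Function.comp_def] using hh'.comp_hasDerivAt (0 : ℝ) hline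

/-- Let `f, S : ℝ^n → ℝ` be smooth and `0 < b ≤ 1`. Suppose `S > 0`
everywhere, `|∇f|² = f − S` everywhere, `f(x) → ∞` as `|x| → ∞`, and
`⟨∇S, ∇f⟩ ≥ (2b/f)·|∇f|²` at every point where `f ≥ 1`. Then `S ≥ b·ln f` at every
point where `f ≥ 1`. -/
theorem scalar_curvature_log_lower_bound {n : ℕ}
    (f S : EuclideanSpace ℝ (Fin n) → ℝ)
    (hf : ContDiff ℝ (⊤ : ℕ∞) f) (hS : ContDiff ℝ (⊤ : ℕ∞) S)
    (b : ℝ) (hb0 : 0 < b) (hb1 : b ≤ 1)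
    (hSpos : ∀ x, 0 < S x)
    (hgrad : ∀ x, ‖gradient f x‖ ^ 2 = f x - S x)
    (hinfty : Filter.Tendsto f (Bornology.cobounded (EuclideanSpace ℝ (Fin n)))
      Filter.atTop)
    (hRic : ∀ x, 1 ≤ f x →
      (2 * b / f x) * ‖gradient f x‖ ^ 2 ≤ ⟪gradient S x, gradient f x⟫) :
    ∀ x, 1 ≤ f x → b * Real.log (f x) ≤ S x := by
  intro x hx
  have hfd : Differentiable ℝ f := hf.differentiable (by simp)
  have hSd : Differentiable ℝ S := hS.differentiable (by simp)
  set K := {y | 1 ≤ f y ∧ f y ≤ f x}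
  have hKclosed : IsClosed K :=
    (isClosed_le continuous_const hf.continuous).inter
      (isClosed_le hf.continuous continuous_const)
  have hKbdd : Bornology.IsBounded K := by
    rw [Bornology.isBounded_def]
    filter_upwards [hinfty.eventually_gt_atTop (f x)] with y hy hyK
    exact absurd hyK.2 (not_le.2 hy)
  have hKcompact : IsCompact K := Metric.isCompact_of_isClosed_isBounded hKclosed hKbdd
  have hcont : ContinuousOn (fun y => S y - b * Real.log (f y)) K := by
    refine hS.continuous.continuousOn.sub (continuousOn_const.mul
      (hf.continuous.continuousOn.log fun y hy => ?_))
    have := hy.1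
    positivity
  obtain ⟨p, hpK, hpmin⟩ := hKcompact.exists_isMinOn ⟨x, hx, le_rfl⟩ hcont
  suffices hp : 0 ≤ S p - b * Real.log (f p) by
    have := hpmin (show x ∈ K from ⟨hx, le_rfl⟩)
    simp only [Set.mem_ofPred_eq] at this
    linarith
  by_contra! hneg
  have hp1 : 1 < f p := by
    refine lt_of_le_of_ne hpK.1 fun h => ?_
    rw [← h, Real.log_one] at hneg
    linarith [hSpos p]
  have hp0 : 0 < f p := by linarith
  set v := gradient f p with hv
  have hvpos : 0 < ‖v‖ ^ 2 := by
    rw [hgrad]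
    have h1 := Real.log_le_sub_one_of_pos hp0
    have h2 : b * Real.log (f p) ≤ Real.log (f p) :=
      mul_le_of_le_one_left (Real.log_nonneg hp1.le) hb1
    linarith
  have hfderiv := (hfd p).hasDerivAt_comp_sub_smul v
  rw [← hv, real_inner_self_eq_norm_sq] at hfderiv
  have huderiv := ((hSd p).hasDerivAt_comp_sub_smul v).sub
    ((hfderiv.log (by simpa using hp0.ne')).const_mul b)
  have huneg : -⟪gradient S p, v⟫ - b * (-‖v‖ ^ 2 / f (p - (0 : ℝ) • v)) < 0 := by
    have h1 := hRic p hp1.le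
    have h2 : 0 < b / f p * ‖v‖ ^ 2 := by positivity
    have h3 : b * (-‖v‖ ^ 2 / f p) = -(b / f p * ‖v‖ ^ 2) := by ring
    have h4 : 2 * b / f p * ‖v‖ ^ 2 = 2 * (b / f p * ‖v‖ ^ 2) := by ring
    rw [zero_smul, sub_zero, h3]
    linarith
  have hgt : ∀ᶠ t in nhdsWithin (0 : ℝ) (Set.Ioi 0), 1 < f (p - t • v) :=
    (hfderiv.continuousAt.eventually_const_lt (by simpa using hp1)).filter_mono
      nhdsWithin_le_nhds
  obtain ⟨t, ht1, ht2, ht3⟩ := (hgt.and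
    ((hfderiv.eventually_nhdsGT_lt_of_neg (neg_lt_zero.2 hvpos)).and
      (huderiv.eventually_nhdsGT_lt_of_neg huneg))).exists
  rw [zero_smul, sub_zero] at ht2
  simp only [Pi.sub_apply, zero_smul, sub_zero] at ht3
  exact absurd (hpmin (show p - t • v ∈ K from ⟨ht1.le, ht2.le.trans hpK.2⟩)) (not_le.2 ht3)
end
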